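/- Let κ, δ, σ, τ, r, λ > 0, θ ∈ ℝ, s ∈ (0, 1). Let Z be a standard normal random variable and let β be independent of Z with the sparse distribution Π: β = 0 with probability 1 − s, and conditional on being nonzero β is Gaussian with mean 0 and variance κ²/s. Set c = λστ, v₁ = στ·√(θ²κ²/s + r²/δ), v₂ = στr/√δ. Then E[η(στ(θβ + (r/√δ)Z), λστ)²] = s·2((v₁² + c²)·Q(c/v₁) − c·v₁·φ(c/v₁)) + (1 − s)·2((v₂² + c²)·Q(c/v₂) − c·v₂·φ(c/v₂)), where φ(t) = e^{−t²/2}/√(2π) and Q(t) = ∫_t^∞ φ(x) dx. -/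

import Mathlib

open MeasureTheory ProbabilityTheory

/-- The soft-thresholding function η(x, t) = sign(x)·max(|x| − t, 0). -/
noncomputable def softThresh (x t : ℝ) : ℝ := Real.sign x * max (|x| - t) 0

/-- The standard normal density φ(t) = e^{−t²/2}/√(2π). -/
noncomputable def gaussPdf (t : ℝ) : ℝ := Real.exp (-t ^ 2 / 2) / Real.sqrt (2 * Real.pi)

/-- The Gaussian tail function Q(t) = ∫_t^∞ φ(x) dx. -/
noncomputable def gaussQ (t : ℝ) : ℝ := ∫ x in Set.Ioi t, gaussPdf x

/-- The sparse prior Π = (1 − s)·δ₀ + s·N(0, κ²/s). -/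
noncomputable def sparseDist (s κ : ℝ) : Measure ℝ :=
  ENNReal.ofReal (1 - s) • Measure.dirac (0 : ℝ) +
    ENNReal.ofReal s • gaussianReal 0 ((κ ^ 2 / s).toNNReal)

lemma measurable_softThresh (t : ℝ) : Measurable fun x ↦ softThresh x t := by
  have h : (fun x ↦ softThresh x t) =
      fun x ↦ (if x < 0 then -1 else if 0 < x then 1 else 0) * max (|x| - t) 0 := by
    ext x
    rfl
  rw [h]
  refine Measurable.mul ?_ (by fun_prop)
  exact Measurable.ite measurableSet_Iio measurable_const
    (Measurable.ite measurableSet_Ioi measurable_const measurable_const)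

lemma softThresh_sq {t : ℝ} (ht : 0 ≤ t) (x : ℝ) :
    softThresh x t ^ 2 = max (|x| - t) 0 ^ 2 := by
  unfold softThresh
  rcases lt_trichotomy x 0 with h | rfl | h
  · simp [Real.sign_of_neg h]
  · simp [ht]
  · simp [Real.sign_of_pos h]

lemma softThresh_sq_le {t : ℝ} (ht : 0 ≤ t) (x : ℝ) : softThresh x t ^ 2 ≤ x ^ 2 := by
  rw [softThresh_sq ht, ← sq_abs x]
  gcongr
  exact max_le (by linarith) (abs_nonneg x)

lemma gaussPdf_eq (x : ℝ) :
    gaussPdf x = (Real.sqrt (2 * Real.pi))⁻¹ * Real.exp (-(1 / 2) * x ^ 2) := by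
  rw [gaussPdf, div_eq_inv_mul]
  ring_nf

lemma gaussPdf_abs (x : ℝ) : gaussPdf |x| = gaussPdf x := by
  simp [gaussPdf]

lemma gaussianPDFReal_zero_one (x : ℝ) : gaussianPDFReal 0 1 x = gaussPdf x := by
  simp [gaussianPDFReal, gaussPdf, div_eq_inv_mul]

lemma hasDerivAt_gaussPdf (x : ℝ) : HasDerivAt gaussPdf (-x * gaussPdf x) x := by
  have h : HasDerivAt (fun y : ℝ ↦ -y ^ 2 / 2) (-x) x := by
    convert! ((hasDerivAt_pow 2 x).neg.div_const 2) using 1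
    norm_num
    ring
  convert! h.exp.div_const (Real.sqrt (2 * Real.pi)) using 1
  rw [gaussPdf]
  ring

lemma integrable_pow_mul_gaussPdf (n : ℕ) : Integrable fun x : ℝ ↦ x ^ n * gaussPdf x := by
  have h := (integrable_rpow_mul_exp_neg_mul_sq (b := 1 / 2) (by norm_num) (s := n)
    (by linarith [n.cast_nonneg (α := ℝ)])).const_mul (Real.sqrt (2 * Real.pi))⁻¹
  refine h.congr (Filter.Eventually.of_forall fun x ↦ ?_)
  simp only [gaussPdf_eq, Real.rpow_natCast]
  ring

lemma integrable_gaussPdf : Integrable gaussPdf := by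
  simpa using integrable_pow_mul_gaussPdf 0

/-- The truncated second moment of a shifted and scaled standard normal variable. -/
lemma integral_Ioi_sq_mul_gaussPdf (v c : ℝ) :
    ∫ x in Set.Ioi (c / v), (v * x - c) ^ 2 * gaussPdf x =
      (v ^ 2 + c ^ 2) * gaussQ (c / v) - c * v * gaussPdf (c / v) := by
  set F : ℝ → ℝ := fun x ↦ (-v ^ 2 * x + 2 * v * c) * gaussPdf x with hF
  set F' : ℝ → ℝ := fun x ↦
    v ^ 2 * (x ^ 2 * gaussPdf x) - 2 * v * c * (x ^ 1 * gaussPdf x) - v ^ 2 * gaussPdf x with hF'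
  have hderiv (x : ℝ) : HasDerivAt F (F' x) x := by
    have h : HasDerivAt (fun y : ℝ ↦ -v ^ 2 * y + 2 * v * c) (-v ^ 2) x := by
      simpa using ((hasDerivAt_id x).const_mul (-v ^ 2)).add_const (2 * v * c)
    convert! h.mul (hasDerivAt_gaussPdf x) using 1
    simp only [hF']
    ring
  have hF'int : Integrable F' :=
    (((integrable_pow_mul_gaussPdf 2).const_mul _).sub
      ((integrable_pow_mul_gaussPdf 1).const_mul _)).sub (integrable_gaussPdf.const_mul _)
  have hFint : Integrable F := by
    refine (((integrable_pow_mul_gaussPdf 1).const_mul (-v ^ 2)).add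
      (integrable_gaussPdf.const_mul (2 * v * c))).congr (Filter.Eventually.of_forall fun x ↦ ?_)
    simp only [hF, Pi.add_apply]
    ring
  have hlim := tendsto_zero_of_hasDerivAt_of_integrableOn_Ioi (a := c / v)
    (fun x _ ↦ hderiv x) hF'int.integrableOn hFint.integrableOn
  have hFTC := integral_Ioi_of_hasDerivAt_of_tendsto' (a := c / v)
    (fun x _ ↦ hderiv x) hF'int.integrableOn hlim
  have hsplit (x : ℝ) : (v * x - c) ^ 2 * gaussPdf x = (v ^ 2 + c ^ 2) * gaussPdf x + F' x := by
    simp only [hF']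
    ring
  simp_rw [hsplit]
  rw [integral_add (integrable_gaussPdf.const_mul _).integrableOn hF'int.integrableOn,
    integral_const_mul, hFTC, ← gaussQ]
  simp only [hF]
  field_simp
  ring

lemma integral_softThresh_sq_gaussianReal_one {v c : ℝ} (hv : 0 < v) (hc : 0 ≤ c) :
    ∫ x, softThresh (v * x) c ^ 2 ∂gaussianReal 0 1 =
      2 * ((v ^ 2 + c ^ 2) * gaussQ (c / v) - c * v * gaussPdf (c / v)) := by
  rw [integral_gaussianReal_eq_integral_smul one_ne_zero, ← integral_Ioi_sq_mul_gaussPdf]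
  have habs (x : ℝ) : gaussianPDFReal 0 1 x • softThresh (v * x) c ^ 2 =
      (fun y ↦ max (v * y - c) 0 ^ 2 * gaussPdf y) |x| := by
    rw [gaussianPDFReal_zero_one, softThresh_sq hc, abs_mul, abs_of_pos hv, smul_eq_mul, mul_comm]
    simp only [gaussPdf_abs]
  simp_rw [habs]
  rw [integral_comp_abs (f := fun y ↦ max (v * y - c) 0 ^ 2 * gaussPdf y)]
  congr 1
  have hsub : Set.Ioi (c / v) ⊆ Set.Ioi 0 := Set.Ioi_subset_Ioi (by positivity)
  rw [setIntegral_eq_of_subset_of_forall_sdiff_eq_zero measurableSet_Ioi hsub]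
  · refine setIntegral_congr_fun measurableSet_Ioi fun x hx ↦ ?_
    have : c < v * x := by
      have := (div_lt_iff₀ hv).1 hx
      linarith
    simp only [max_eq_left (sub_nonneg.2 this.le)]
  · intro x hx
    have hxc : x ≤ c / v := not_lt.1 hx.2
    have : v * x - c ≤ 0 := by
      have := (le_div_iff₀ hv).1 hxc
      linarith
    simp [max_eq_right this]

lemma integral_softThresh_sq_gaussianReal {v c : ℝ} (hv : 0 < v) (hc : 0 ≤ c) {w : NNReal}
    (hw : (w : ℝ) = v ^ 2) :
    ∫ x, softThresh x c ^ 2 ∂gaussianReal 0 w =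
      2 * ((v ^ 2 + c ^ 2) * gaussQ (c / v) - c * v * gaussPdf (c / v)) := by
  have hmap : gaussianReal 0 w = (gaussianReal 0 1).map (v * ·) := by
    rw [gaussianReal_map_const_mul, mul_zero, mul_one]
    congr 1
    exact NNReal.eq hw
  rw [hmap, integral_map (by fun_prop)
    ((measurable_softThresh c).pow_const 2).aestronglyMeasurable,
    integral_softThresh_sq_gaussianReal_one hv hc]

lemma integrable_softThresh_sq_gaussianReal {c : ℝ} (hc : 0 ≤ c) (w : NNReal) :
    Integrable (fun x ↦ softThresh x c ^ 2) (gaussianReal 0 w) := by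
  have h : Integrable (fun x : ℝ ↦ x ^ 2) (gaussianReal 0 w) :=
    (memLp_id_gaussianReal (μ := 0) (v := w) 2).integrable_sq
  refine h.mono' ((measurable_softThresh c).pow_const 2).aestronglyMeasurable
    (Filter.Eventually.of_forall fun x ↦ ?_)
  rw [Real.norm_of_nonneg (sq_nonneg _)]
  exact softThresh_sq_le hc x

/-- A linear combination of two independent centred Gaussian variables is Gaussian. -/
lemma gaussianReal_prod_map_linear (a b : ℝ) (u w : NNReal) :
    ((gaussianReal 0 u).prod (gaussianReal 0 w)).map (fun p ↦ a * p.1 + b * p.2) =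
      gaussianReal 0 (.mk (a ^ 2) (sq_nonneg _) * u + .mk (b ^ 2) (sq_nonneg _) * w) := by
  have h := gaussianReal_conv_gaussianReal (m₁ := a * 0) (m₂ := b * 0)
    (v₁ := .mk (a ^ 2) (sq_nonneg _) * u) (v₂ := .mk (b ^ 2) (sq_nonneg _) * w)
  rw [← gaussianReal_map_const_mul, ← gaussianReal_map_const_mul, Measure.conv,
    Measure.map_prod_map _ _ (by fun_prop) (by fun_prop),
    Measure.map_map (by fun_prop) (by fun_prop)] at h
  simpa [Function.comp_def] using h

lemma integral_softThresh_sq_prod {a b v c : ℝ} {u : NNReal} (hv : 0 < v) (hc : 0 ≤ c)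
    (h : a ^ 2 * u + b ^ 2 = v ^ 2) :
    ∫ p : ℝ × ℝ, softThresh (a * p.1 + b * p.2) c ^ 2
        ∂((gaussianReal 0 u).prod (gaussianReal 0 1)) =
      2 * ((v ^ 2 + c ^ 2) * gaussQ (c / v) - c * v * gaussPdf (c / v)) := by
  rw [← integral_map (φ := fun p : ℝ × ℝ ↦ a * p.1 + b * p.2)
    (f := fun x ↦ softThresh x c ^ 2) (by fun_prop)
    ((measurable_softThresh c).pow_const 2).aestronglyMeasurable, gaussianReal_prod_map_linear]
  exact integral_softThresh_sq_gaussianReal hv hc (by simpa using h)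

lemma integrable_softThresh_sq_prod (a b : ℝ) {c : ℝ} (hc : 0 ≤ c) (u : NNReal) :
    Integrable (fun p : ℝ × ℝ ↦ softThresh (a * p.1 + b * p.2) c ^ 2)
      ((gaussianReal 0 u).prod (gaussianReal 0 1)) := by
  have h := integrable_softThresh_sq_gaussianReal hc
    (.mk (a ^ 2) (sq_nonneg _) * u + .mk (b ^ 2) (sq_nonneg _) * 1)
  rw [← gaussianReal_prod_map_linear] at h
  exact h.comp_measurable (by fun_prop)

/-- With β ∼ Π (sparse prior) independent of Z standard normal, c = λστ,
v₁ = στ√(θ²κ²/s + r²/δ), v₂ = στr/√δ: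
E[η(στ(θβ + (r/√δ)Z), λστ)²]
  = s·2((v₁² + c²)Q(c/v₁) − c·v₁·φ(c/v₁)) + (1 − s)·2((v₂² + c²)Q(c/v₂) − c·v₂·φ(c/v₂)). -/
theorem stmt17 (κ δ σ τ r lam θ s : ℝ)
    (hκ : 0 < κ) (hδ : 0 < δ) (hσ : 0 < σ) (hτ : 0 < τ) (hr : 0 < r) (hlam : 0 < lam)
    (hs0 : 0 < s) (hs1 : s < 1) :
    ∫ p : ℝ × ℝ,
        softThresh (σ * τ * (θ * p.1 + (r / Real.sqrt δ) * p.2)) (lam * σ * τ) ^ 2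
        ∂((sparseDist s κ).prod (gaussianReal 0 1))
      = s * (2 * (((σ * τ * Real.sqrt (θ ^ 2 * κ ^ 2 / s + r ^ 2 / δ)) ^ 2 + (lam * σ * τ) ^ 2) *
              gaussQ (lam * σ * τ / (σ * τ * Real.sqrt (θ ^ 2 * κ ^ 2 / s + r ^ 2 / δ))) -
            (lam * σ * τ) * (σ * τ * Real.sqrt (θ ^ 2 * κ ^ 2 / s + r ^ 2 / δ)) *
              gaussPdf (lam * σ * τ / (σ * τ * Real.sqrt (θ ^ 2 * κ ^ 2 / s + r ^ 2 / δ))))) +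
        (1 - s) * (2 * (((σ * τ * r / Real.sqrt δ) ^ 2 + (lam * σ * τ) ^ 2) *
              gaussQ (lam * σ * τ / (σ * τ * r / Real.sqrt δ)) -
            (lam * σ * τ) * (σ * τ * r / Real.sqrt δ) *
              gaussPdf (lam * σ * τ / (σ * τ * r / Real.sqrt δ)))) := by
  have hc : 0 ≤ lam * σ * τ := by positivity
  have hδ2 : Real.sqrt δ ^ 2 = δ := Real.sq_sqrt hδ.le
  have hu : (((κ ^ 2 / s).toNNReal : NNReal) : ℝ) = κ ^ 2 / s :=
    Real.coe_toNNReal _ (by positivity)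
  have harg (p : ℝ × ℝ) : σ * τ * (θ * p.1 + (r / Real.sqrt δ) * p.2) =
      (σ * τ * θ) * p.1 + (σ * τ * r / Real.sqrt δ) * p.2 := by ring
  simp_rw [harg]
  rw [sparseDist, ← gaussianReal_zero_var, Measure.add_prod, Measure.prod_smul_left,
    Measure.prod_smul_left, integral_add_measure
      ((integrable_softThresh_sq_prod _ _ hc _).smul_measure ENNReal.ofReal_ne_top)
      ((integrable_softThresh_sq_prod _ _ hc _).smul_measure ENNReal.ofReal_ne_top),
    integral_smul_measure, integral_smul_measure,
    ENNReal.toReal_ofReal (by linarith), ENNReal.toReal_ofReal hs0.le,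
    integral_softThresh_sq_prod (v := σ * τ * r / Real.sqrt δ) (by positivity) hc (by simp),
    integral_softThresh_sq_prod
      (v := σ * τ * Real.sqrt (θ ^ 2 * κ ^ 2 / s + r ^ 2 / δ)) (by positivity) hc
      (by
        rw [hu, mul_pow _ (Real.sqrt _), Real.sq_sqrt (by positivity), div_pow, hδ2]
        ring),
    smul_eq_mul, smul_eq_mul, add_comm]
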